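/- Monotonicity of profile components, supercritical case: Assume a² ≥ 0, b², c² > 0 with b⁴ > 3a²c², let k ∈ ℤ \ {0} and R ∈ (0,∞]. Let (u,v) be any profile solution on (0,R) such that u(r) > 0 and v(r) < 0 for all r ∈ (0,R). Then u'(r) > 0 and v'(r) < 0 for all r ∈ (0,R). -/

import Mathlib

open Real MeasureTheory Filter Set Topology
open scoped ENNReal

noncomputable section

/-- `s₊ = (b² + √(b⁴ + 24 a² c²)) / (4c²)`, where `a2 = a²`, `b2 = b²`, `c2 = c²`. -/
def sPlus (a2 b2 c2 : ℝ) : ℝ := (b2 + Real.sqrt (b2 ^ 2 + 24 * a2 * c2)) / (4 * c2)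

/-- `h(p,q) = p(−a² + (2b²/√6)q + c²(p² + q²))`. -/
def hfun (a2 b2 c2 p q : ℝ) : ℝ :=
  p * (-a2 + 2 * b2 / Real.sqrt 6 * q + c2 * (p ^ 2 + q ^ 2))

/-- `g(p,q) = q(−a² − (b²/√6)q + c²(p² + q²)) + (b²/√6)p²`. -/
def gfun (a2 b2 c2 p q : ℝ) : ℝ :=
  q * (-a2 - b2 / Real.sqrt 6 * q + c2 * (p ^ 2 + q ^ 2)) + b2 / Real.sqrt 6 * p ^ 2

/-- The interval `(0, R)` for `R ∈ (0,∞]`, as a subset of `ℝ`. -/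
def Iset (R : ℝ≥0∞) : Set ℝ := {r : ℝ | 0 < r ∧ ENNReal.ofReal r < R}

/-- The filter of left-approach to the right endpoint `R`; `atTop` when `R = ∞`. -/
def endFilter (R : ℝ≥0∞) : Filter ℝ :=
  if R = ⊤ then Filter.atTop else nhdsWithin R.toReal (Set.Iio R.toReal)

/-- A profile solution on `(0,R)`: a C² pair `(u,v)` solving the radial ODE system with the
natural boundary conditions at `0` and at `R`. -/
structure ProfileSolution (a2 b2 c2 : ℝ) (k : ℤ) (R : ℝ≥0∞) (u v : ℝ → ℝ) : Prop where
  smooth_u : ContDiffOn ℝ 2 u (Iset R)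
  smooth_v : ContDiffOn ℝ 2 v (Iset R)
  ode_u : ∀ r ∈ Iset R,
    deriv (deriv u) r + deriv u r / r - (k : ℝ) ^ 2 / r ^ 2 * u r
      = hfun a2 b2 c2 (u r) (v r)
  ode_v : ∀ r ∈ Iset R,
    deriv (deriv v) r + deriv v r / r = gfun a2 b2 c2 (u r) (v r)
  bc0_u : Filter.Tendsto u (nhdsWithin 0 (Set.Ioi 0)) (nhds 0)
  bc0_v : Filter.Tendsto (deriv v) (nhdsWithin 0 (Set.Ioi 0)) (nhds 0)
  bcR_u : Filter.Tendsto u (endFilter R) (nhds (sPlus a2 b2 c2 / Real.sqrt 2))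
  bcR_v : Filter.Tendsto v (endFilter R) (nhds (-(sPlus a2 b2 c2 / Real.sqrt 6)))

theorem eventually_right_lt_of_deriv_neg {f f' : ℝ → ℝ} {x : ℝ}
    (hf : ∀ᶠ y in 𝓝 x, HasDerivAt f (f' y) y) (hneg : ∀ᶠ y in 𝓝[>] x, f' y < 0) :
    ∀ᶠ y in 𝓝[>] x, f y < f x := by
  obtain ⟨δ, hδ, hball⟩ := Metric.eventually_nhds_iff.1 hf
  obtain ⟨z, hz, hzneg⟩ := (mem_nhdsGT_iff_exists_Ioo_subset).1 hneg
  have hz' : x < z := hz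
  have hlt : x < min z (x + δ) := lt_min hz' (by linarith)
  filter_upwards [Ioo_mem_nhdsGT hlt] with y hy
  have hder : ∀ t ∈ Icc x y, HasDerivAt f (f' t) t := by
    intro t ht
    apply hball
    have := hy.2.trans_le (min_le_right _ _)
    rw [Real.dist_eq, abs_lt]
    constructor <;> linarith [ht.1, ht.2]
  have hanti : StrictAntiOn f (Icc x y) := by
    apply strictAntiOn_of_deriv_neg (convex_Icc x y)
    · exact fun t ht => (hder t ht).continuousAt.continuousWithinAt
    · intro t ht
      rw [interior_Icc] at ht
      rw [(hder t ⟨ht.1.le, ht.2.le⟩).deriv]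
      exact hzneg ⟨ht.1, ht.2.trans (hy.2.trans_le (min_le_left _ _))⟩
  exact hanti ⟨le_rfl, hy.1.le⟩ ⟨hy.1.le, le_rfl⟩ hy.1

theorem eventually_right_neg_of_hasDerivAt_neg {f : ℝ → ℝ} {x m : ℝ}
    (h : HasDerivAt f m x) (h0 : f x = 0) (hm : m < 0) : ∀ᶠ y in 𝓝[>] x, f y < 0 := by
  have ht := (hasDerivAt_iff_tendsto_slope.1 h).mono_left
    (nhdsWithin_mono x (fun y (hy : x < y) => (ne_of_gt hy : y ≠ x)))
  filter_upwards [ht.eventually_lt_const hm, self_mem_nhdsWithin] with y hy hxy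
  have hxy' : 0 < y - x := sub_pos.2 hxy
  rw [slope_def_field, h0, sub_zero, div_lt_iff₀ hxy', zero_mul] at hy
  exact hy

theorem eventually_right_lt_of_second_deriv_neg {f f' : ℝ → ℝ} {x m : ℝ}
    (hf : ∀ᶠ y in 𝓝 x, HasDerivAt f (f' y) y) (hf' : HasDerivAt f' m x) (h0 : f' x = 0)
    (hm : m < 0) : ∀ᶠ y in 𝓝[>] x, f y < f x :=
  eventually_right_lt_of_deriv_neg hf (eventually_right_neg_of_hasDerivAt_neg hf' h0 hm)

theorem deriv_nonneg_of_eventually_right_le {f : ℝ → ℝ} {x m : ℝ} (hf : HasDerivAt f m x)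
    (h : ∀ᶠ y in 𝓝[>] x, f x ≤ f y) : 0 ≤ m := by
  by_contra! hm
  have hd : HasDerivAt (fun y => f y - f x) m x := hf.sub_const _
  have := eventually_right_neg_of_hasDerivAt_neg hd (by simp) hm
  obtain ⟨y, hy1, hy2⟩ := (this.and h).exists
  linarith

theorem lap_nonpos_of_isLocalMax {f f' f'' : ℝ → ℝ} {x : ℝ}
    (hf : ∀ᶠ y in 𝓝 x, HasDerivAt f (f' y) y) (hf' : HasDerivAt f' (f'' x) x)
    (hmax : IsLocalMax f x) : f'' x + f' x / x ≤ 0 := by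
  have h0 : f' x = 0 := hmax.hasDerivAt_eq_zero hf.self_of_nhds
  rw [h0, zero_div, add_zero]
  by_contra! hpos
  have := eventually_right_lt_of_second_deriv_neg (f := fun y => - f y) (f' := fun y => - f' y)
    (hf.mono fun y hy => hy.neg) hf'.neg (by simp [h0]) (by linarith)
  have h2 : ∀ᶠ y in 𝓝[>] x, f y ≤ f x := hmax.filter_mono nhdsWithin_le_nhds
  obtain ⟨y, hy1, hy2⟩ := (this.and h2).exists
  linarith

theorem lap_le_lap_of_two_point_min {f f' f'' : ℝ → ℝ} {r s : ℝ} (hs : 0 < s) (hr : 0 < r)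
    (hfr : ∀ᶠ y in 𝓝 r, HasDerivAt f (f' y) y) (hfs : ∀ᶠ y in 𝓝 s, HasDerivAt f (f' y) y)
    (hr' : HasDerivAt f' (f'' r) r) (hs' : HasDerivAt f' (f'' s) s)
    (hmin : ∀ᶠ z : ℝ × ℝ in 𝓝 (r, s), r + s ≤ z.1 + z.2 → f r - f s ≤ f z.1 - f z.2) :
    f'' s + f' s / s ≤ f'' r + f' r / r := by
  have key : ∀ α β : ℝ, 0 ≤ α + β →
      ∀ᶠ t in 𝓝[>] (0 : ℝ), f r - f s ≤ f (r + α * t) - f (s + β * t) := by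
    intro α β hαβ
    have hc : Tendsto (fun t : ℝ => (r + α * t, s + β * t)) (𝓝 0) (𝓝 (r, s)) := by
      have : Continuous (fun t : ℝ => (r + α * t, s + β * t)) := by fun_prop
      simpa using this.tendsto 0
    filter_upwards [nhdsWithin_le_nhds (hc.eventually hmin), self_mem_nhdsWithin] with t ht htpos
    apply ht
    have : 0 ≤ (α + β) * t := mul_nonneg hαβ (le_of_lt htpos)
    linarith
  have hd : ∀ α β : ℝ, ∀ᶠ t in 𝓝 (0 : ℝ), HasDerivAt (fun t => f (r + α * t) - f (s + β * t))
      (f' (r + α * t) * α - f' (s + β * t) * β) t := by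
    intro α β
    have h1 : Tendsto (fun t : ℝ => r + α * t) (𝓝 0) (𝓝 r) := by
      have : Continuous (fun t : ℝ => r + α * t) := by fun_prop
      simpa using this.tendsto 0
    have h2 : Tendsto (fun t : ℝ => s + β * t) (𝓝 0) (𝓝 s) := by
      have : Continuous (fun t : ℝ => s + β * t) := by fun_prop
      simpa using this.tendsto 0
    filter_upwards [h1.eventually hfr, h2.eventually hfs] with t htr hts
    have e1 : HasDerivAt (fun t : ℝ => r + α * t) α t := by
      simpa using ((hasDerivAt_id t).const_mul α).const_add r
    have e2 : HasDerivAt (fun t : ℝ => s + β * t) β t := by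
      simpa using ((hasDerivAt_id t).const_mul β).const_add s
    exact (HasDerivAt.comp t htr e1).sub (HasDerivAt.comp t hts e2)
  have hslope : ∀ α β : ℝ, 0 ≤ α + β → 0 ≤ f' r * α - f' s * β := by
    intro α β h
    have := deriv_nonneg_of_eventually_right_le (hd α β).self_of_nhds
      (by simpa using key α β h)
    simpa using this
  have h1 := hslope 1 0 (by norm_num)
  have h2 := hslope 0 1 (by norm_num)
  have h3 := hslope 1 (-1) (by norm_num)
  have h4 := hslope (-1) 1 (by norm_num)
  have hsum : f' r + f' s = 0 := by linarith
  have hsecond : f'' s ≤ f'' r := by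
    by_contra! hlt
    have hdd : HasDerivAt (fun t => f' (r + 1 * t) * 1 - f' (s + (-1) * t) * (-1))
        (f'' r - f'' s) 0 := by
      have e1 : HasDerivAt (fun t : ℝ => r + 1 * t) 1 0 := by
        simpa using ((hasDerivAt_id (0 : ℝ)).const_mul 1).const_add r
      have e2 : HasDerivAt (fun t : ℝ => s + (-1) * t) (-1) 0 := by
        simpa using ((hasDerivAt_id (0 : ℝ)).const_mul (-1)).const_add s
      have c1 : HasDerivAt (fun t => f' (r + 1 * t)) (f'' r * 1) 0 :=
        HasDerivAt.comp 0 (h₂ := f') (by simpa using hr') e1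
      have c2 : HasDerivAt (fun t => f' (s + (-1) * t)) (f'' s * (-1)) 0 :=
        HasDerivAt.comp 0 (h₂ := f') (by simpa using hs') e2
      exact ((c1.mul_const 1).sub (c2.mul_const (-1))).congr_deriv (by ring)
    have := eventually_right_lt_of_second_deriv_neg (hd 1 (-1)) hdd (by simpa using hsum)
      (by linarith)
    obtain ⟨t, ht1, ht2⟩ := (this.and (key 1 (-1) (by norm_num))).exists
    simp at ht1 ht2
    linarith
  have h5 : f' s / s ≤ 0 := div_nonpos_of_nonpos_of_nonneg (by linarith) hs.le
  have h6 : 0 ≤ f' r / r := div_nonneg (by linarith) hr.le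
  linarith

theorem exists_reflection_lt_of_third_deriv_neg {f f' f'' : ℝ → ℝ} {x m : ℝ}
    (hf : ∀ᶠ y in 𝓝 x, HasDerivAt f (f' y) y) (hf' : ∀ᶠ y in 𝓝 x, HasDerivAt f' (f'' y) y)
    (hf'' : HasDerivAt f'' m x) (h0 : f' x = 0) (hm : m < 0) :
    ∀ᶠ t in 𝓝[>] (0 : ℝ), f (x + t) < f (x - t) := by
  have h1 : Tendsto (fun t : ℝ => x + t) (𝓝 0) (𝓝 x) := by
    have : Continuous (fun t : ℝ => x + t) := by fun_prop
    simpa using this.tendsto 0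
  have h2 : Tendsto (fun t : ℝ => x - t) (𝓝 0) (𝓝 x) := by
    have : Continuous (fun t : ℝ => x - t) := by fun_prop
    simpa using this.tendsto 0
  have e1 : ∀ t : ℝ, HasDerivAt (fun t : ℝ => x + t) 1 t := fun t =>
    (hasDerivAt_id t).const_add x
  have e2 : ∀ t : ℝ, HasDerivAt (fun t : ℝ => x - t) (-1) t := fun t =>
    (hasDerivAt_id t).const_sub x
  have d0 : ∀ᶠ t in 𝓝 (0 : ℝ), HasDerivAt (fun t => f (x + t) - f (x - t))
      (f' (x + t) + f' (x - t)) t := by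
    filter_upwards [h1.eventually hf, h2.eventually hf] with t ha hb
    exact ((HasDerivAt.comp t ha (e1 t)).sub (HasDerivAt.comp t hb (e2 t))).congr_deriv (by ring)
  have d1 : ∀ᶠ t in 𝓝 (0 : ℝ), HasDerivAt (fun t => f' (x + t) + f' (x - t))
      (f'' (x + t) - f'' (x - t)) t := by
    filter_upwards [h1.eventually hf', h2.eventually hf'] with t ha hb
    exact ((HasDerivAt.comp t ha (e1 t)).add (HasDerivAt.comp t hb (e2 t))).congr_deriv (by ring)
  have d2 : HasDerivAt (fun t => f'' (x + t) - f'' (x - t)) (2 * m) 0 := by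
    have c1 : HasDerivAt (fun t => f'' (x + t)) (m * 1) 0 :=
      HasDerivAt.comp 0 (h₂ := f'') (by simpa using hf'') (e1 0)
    have c2 : HasDerivAt (fun t => f'' (x - t)) (m * (-1)) 0 :=
      HasDerivAt.comp 0 (h₂ := f'') (by simpa using hf'') (e2 0)
    exact (c1.sub c2).congr_deriv (by ring)
  have n1 := eventually_right_lt_of_second_deriv_neg d1 d2 (by simp) (by linarith)
  simp only [add_zero, sub_zero, h0] at n1
  have n0 := eventually_right_lt_of_deriv_neg d0 n1
  filter_upwards [n0] with t ht
  simp at ht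
  exact ht

theorem eventually_right_zero_lt_of_lap_pos {f f' f'' : ℝ → ℝ} (hc : Continuous f)
    (hf : ∀ᶠ y in 𝓝[>] (0 : ℝ), HasDerivAt f (f' y) y)
    (hf' : ∀ᶠ y in 𝓝[>] (0 : ℝ), HasDerivAt f' (f'' y) y)
    (h0 : Tendsto f' (𝓝[>] 0) (𝓝 0))
    (hpos : ∀ᶠ y in 𝓝[>] (0 : ℝ), 0 < f'' y + f' y / y) :
    ∀ᶠ y in 𝓝[>] (0 : ℝ), f 0 < f y := by
  obtain ⟨δ, hδ, hall⟩ := mem_nhdsGT_iff_exists_Ioo_subset.1 ((hf.and hf').and hpos)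
  have hδ' : 0 < δ := hδ
  have hg : ∀ y ∈ Ioo 0 δ, HasDerivAt (fun y => y * f' y) (f' y + y * f'' y) y := by
    intro y hy
    exact ((hasDerivAt_id y).mul (hall hy).1.2).congr_deriv (by simp)
  have hmono : StrictMonoOn (fun y => y * f' y) (Ioo 0 δ) := by
    apply strictMonoOn_of_deriv_pos (convex_Ioo 0 δ)
    · exact fun y hy => (hg y hy).continuousAt.continuousWithinAt
    · intro y hy
      rw [interior_Ioo] at hy
      rw [(hg y hy).deriv]
      have h3 : 0 < f'' y + f' y / y := (hall hy).2
      have h4 : f' y + y * f'' y = y * (f'' y + f' y / y) := by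
        field_simp [hy.1.ne']
        ring
      rw [h4]
      exact mul_pos hy.1 h3
  have hlim : Tendsto (fun y => y * f' y) (𝓝[>] 0) (𝓝 0) := by
    have : Tendsto (fun y : ℝ => y) (𝓝[>] 0) (𝓝 0) := nhdsWithin_le_nhds
    simpa using this.mul h0
  have hfpos : ∀ y ∈ Ioo 0 δ, 0 < f' y := by
    intro y hy
    have hy2 : y / 2 ∈ Ioo 0 δ := ⟨by linarith [hy.1], by linarith [hy.1, hy.2]⟩
    have h1 : 0 ≤ y / 2 * f' (y / 2) := by
      apply le_of_tendsto hlim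
      filter_upwards [Ioo_mem_nhdsGT hy2.1] with z hz
      exact (hmono ⟨hz.1, hz.2.trans hy2.2⟩ hy2 hz.2).le
    have h2 : y / 2 * f' (y / 2) < y * f' y := hmono hy2 hy (by linarith [hy.1])
    exact pos_of_mul_pos_right (h1.trans_lt h2) hy.1.le
  filter_upwards [Ioo_mem_nhdsGT hδ'] with y hy
  have : StrictMonoOn f (Icc 0 y) := by
    apply strictMonoOn_of_deriv_pos (convex_Icc 0 y) hc.continuousOn
    intro t ht
    rw [interior_Icc] at ht
    have ht' : t ∈ Ioo 0 δ := ⟨ht.1, ht.2.trans hy.2⟩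
    rw [(hall ht').1.1.deriv]
    exact hfpos t ht'
  exact this ⟨le_rfl, hy.1.le⟩ ⟨hy.1.le, le_rfl⟩ hy.1

/-- The profile system in the unknowns `p = u / √3`, `w = -v`, for which the boundary value at the
right endpoint is `(ω, ω)`. The functions are extended continuously to `ℝ`, by `(ω, ω)` beyond the
right endpoint of the interval `I`. -/
structure RescaledProfile (a β c ω κ : ℝ) (I : Set ℝ) (p p' p'' w w' w'' : ℝ → ℝ) : Prop where
  a_nonneg : 0 ≤ a
  c_pos : 0 < c
  ω_pos : 0 < ω
  κ_pos : 0 < κ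
  rel : 4 * c * ω ^ 2 = a + 2 * β * ω
  sup : c * ω < β
  isOpen : IsOpen I
  pos : ∀ r ∈ I, 0 < r
  down : ∀ s ∈ I, ∀ t, 0 < t → t ≤ s → t ∈ I
  cont_p : Continuous p
  cont_w : Continuous w
  out : ∀ r, 0 < r → r ∉ I → p r = ω ∧ w r = ω
  p_zero : p 0 = 0
  p_pos : ∀ r ∈ I, 0 < p r
  endpoint : ∀ ε > 0, ∃ M ∈ I, ∀ r ≥ M, |p r - ω| < ε ∧ |w r - ω| < ε
  deriv_p : ∀ r ∈ I, HasDerivAt p (p' r) r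
  deriv_p' : ∀ r ∈ I, HasDerivAt p' (p'' r) r
  deriv_w : ∀ r ∈ I, HasDerivAt w (w' r) r
  deriv_w' : ∀ r ∈ I, HasDerivAt w' (w'' r) r
  ode_p : ∀ r ∈ I, p'' r + p' r / r =
    κ / r ^ 2 * p r + p r * (-a - 2 * β * w r + c * (3 * p r ^ 2 + w r ^ 2))
  ode_w : ∀ r ∈ I, w'' r + w' r / r =
    w r * (-a + β * w r + c * (3 * p r ^ 2 + w r ^ 2)) - 3 * β * p r ^ 2
  w'_zero : Tendsto w' (𝓝[>] 0) (𝓝 0)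

namespace RescaledProfile

variable {a β c ω κ : ℝ} {I : Set ℝ} {p p' p'' w w' w'' : ℝ → ℝ}

theorem β_pos (h : RescaledProfile a β c ω κ I p p' p'' w w' w'') : 0 < β :=
  (mul_pos h.c_pos h.ω_pos).trans h.sup

theorem β_le (h : RescaledProfile a β c ω κ I p p' p'' w w' w'') : β ≤ 2 * c * ω := by
  have h1 := h.rel
  have h2 := h.a_nonneg
  have h3 := h.ω_pos
  by_contra! hlt
  nlinarith [mul_pos h3 (sub_pos.2 hlt)]

theorem mem_nhds (h : RescaledProfile a β c ω κ I p p' p'' w w' w'') {r : ℝ} (hr : r ∈ I) :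
    ∀ᶠ y in 𝓝 r, y ∈ I := h.isOpen.mem_nhds hr

theorem mem_nhdsGT_zero (h : RescaledProfile a β c ω κ I p p' p'' w w' w'') :
    ∀ᶠ y in 𝓝[>] (0 : ℝ), y ∈ I := by
  obtain ⟨M, hM, -⟩ := h.endpoint 1 one_pos
  filter_upwards [Ioo_mem_nhdsGT (h.pos M hM)] with y hy
  exact h.down M hM y hy.1 hy.2.le

theorem p_nonneg (h : RescaledProfile a β c ω κ I p p' p'' w w' w'') {r : ℝ} (hr : 0 ≤ r) :
    0 ≤ p r := by
  rcases hr.eq_or_lt with rfl | hr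
  · exact h.p_zero.ge
  · by_cases hrI : r ∈ I
    · exact (h.p_pos r hrI).le
    · exact (h.out r hr hrI).1 ▸ h.ω_pos.le

theorem exists_max_of_endpoint {f : ℝ → ℝ} {K : ℝ}
    (hf : Continuous f) (hout : ∀ r, 0 < r → r ∉ I → f r = K)
    (hend : ∀ ε > 0, ∃ M ∈ I, ∀ r ≥ M, f r < K + ε) {x : ℝ} (hx : 0 ≤ x) (hfx : K < f x) :
    ∃ r, (r = 0 ∨ r ∈ I) ∧ K < f r ∧ ∀ y, 0 ≤ y → f y ≤ f r := by
  obtain ⟨M, hM, hMf⟩ := hend (f x - K) (by linarith)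
  obtain ⟨r, hr, hmax⟩ := isCompact_Icc.exists_isMaxOn (s := Icc 0 (max M x))
    ⟨x, hx, le_max_right _ _⟩ hf.continuousOn
  have hxr : f x ≤ f r := hmax ⟨hx, le_max_right _ _⟩
  refine ⟨r, ?_, hfx.trans_le hxr, ?_⟩
  · rcases hr.1.eq_or_lt with h0 | h0
    · exact Or.inl h0.symm
    · right
      by_contra hrI
      have := hout r h0 hrI
      linarith
  · intro y hy
    by_cases hyM : y ≤ max M x
    · exact hmax ⟨hy, hyM⟩
    · have := hMf y ((le_max_left _ _).trans (not_le.1 hyM).le)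
      linarith

theorem w_zero_lt (h : RescaledProfile a β c ω κ I p p' p'' w w' w'')
    (hpos : 0 < w 0 * (-a + β * w 0 + c * w 0 ^ 2)) : ∀ᶠ y in 𝓝[>] (0 : ℝ), w 0 < w y := by
  apply eventually_right_zero_lt_of_lap_pos h.cont_w
    (h.mem_nhdsGT_zero.mono h.deriv_w) (h.mem_nhdsGT_zero.mono h.deriv_w') h.w'_zero
  have hc : Continuous fun y =>
      w y * (-a + β * w y + c * (3 * p y ^ 2 + w y ^ 2)) - 3 * β * p y ^ 2 := by
    have := h.cont_p
    have := h.cont_w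
    fun_prop
  have hlim := (hc.tendsto 0).mono_left (nhdsWithin_le_nhds (s := Ioi 0))
  rw [h.p_zero] at hlim
  filter_upwards [hlim.eventually_const_lt (u := 0) (by simpa using hpos),
    h.mem_nhdsGT_zero] with y hy hyI
  rwa [h.ode_w y hyI]

theorem isLocalMax_of_max (h : RescaledProfile a β c ω κ I p p' p'' w w' w'') {f : ℝ → ℝ} {r : ℝ}
    (hr : r ∈ I) (hmax : ∀ y, 0 ≤ y → f y ≤ f r) : IsLocalMax f r :=
  (h.mem_nhds hr).mono fun y hy => hmax y (h.pos y hy).le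

theorem pos_of_omega_le (h : RescaledProfile a β c ω κ I p p' p'' w w' w'') {x : ℝ}
    (hx : ω ≤ x) : 0 < -a + β * x + c * x ^ 2 := by
  have h1 := h.rel
  have h2 := h.sup
  have h3 := h.ω_pos
  have h4 := h.c_pos
  have h5 := h.β_pos
  nlinarith [mul_nonneg h5.le (sub_nonneg.2 hx), mul_pos h3 (sub_pos.2 h2),
    mul_nonneg h4.le (mul_nonneg (sub_nonneg.2 hx) (by linarith : 0 ≤ x + ω))]

theorem three_p_add_w_le (h : RescaledProfile a β c ω κ I p p' p'' w w' w'') {x : ℝ}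
    (hx : 0 ≤ x) : 3 * p x + w x ≤ 4 * ω := by
  have hω := h.ω_pos
  by_contra! hlt
  obtain ⟨r, hr, hK, hmax⟩ := exists_max_of_endpoint (f := fun r => 3 * p r + w r) (K := 4 * ω)
    (by have := h.cont_p; have := h.cont_w; fun_prop)
    (by intro r h0 hrI; rw [(h.out r h0 hrI).1, (h.out r h0 hrI).2]; ring)
    (by
      intro ε hε
      obtain ⟨M, hM, hMb⟩ := h.endpoint (ε / 4) (by linarith)
      refine ⟨M, hM, fun r hr => ?_⟩
      obtain ⟨h1, h2⟩ := hMb r hr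
      rw [abs_lt] at h1 h2
      linarith [h1.2, h2.2])
    hx hlt
  rcases hr with rfl | hr
  · simp only [h.p_zero, mul_zero, zero_add] at hK hmax
    have hB := h.w_zero_lt (mul_pos (by linarith) (h.pos_of_omega_le (by linarith)))
    obtain ⟨y, hy, hyI⟩ := (hB.and h.mem_nhdsGT_zero).exists
    have := hmax y (h.pos y hyI).le
    have := h.p_pos y hyI
    linarith
  · have hL := lap_nonpos_of_isLocalMax (f' := fun r => 3 * p' r + w' r)
      (f'' := fun r => 3 * p'' r + w'' r)
      ((h.mem_nhds hr).mono fun y hy => ((h.deriv_p y hy).const_mul 3).add (h.deriv_w y hy))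
      (((h.deriv_p' r hr).const_mul 3).add (h.deriv_w' r hr)) (h.isLocalMax_of_max hr hmax)
    have h1 := h.ode_p r hr
    have h2 := h.ode_w r hr
    have h0 := h.pos r hr
    have hkp : 0 < κ / r ^ 2 * p r :=
      mul_pos (div_pos h.κ_pos (by positivity)) (h.p_pos r hr)
    have e : 3 * p'' r + w'' r + (3 * p' r + w' r) / r
        = 3 * (p'' r + p' r / r) + (w'' r + w' r / r) := by ring
    rw [e, h1, h2] at hL
    generalize p r = P at *
    generalize w r = V at *
    obtain ⟨L, hLd⟩ : ∃ L, L = 3 * P + V := ⟨_, rfl⟩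
    obtain rfl : V = L - 3 * P := by linarith
    have hc := h.c_pos
    have hβ := h.β_pos
    have hrel := h.rel
    have hL0 : 4 * ω < L := by linarith
    have hle := h.β_le
    have q1 : 0 < -a + c * (L / 2) ^ 2 - β * (L / 2) := by
      nlinarith [mul_pos (sub_pos.2 hL0) (by nlinarith : 0 < c * (L + 4 * ω) - 2 * β)]
    have q2 : 0 ≤ c * (L * (L - 4 * P) ^ 2) :=
      mul_nonneg hc.le (mul_nonneg (by linarith) (sq_nonneg _))
    have q3 : 0 ≤ β * (L - 4 * P) ^ 2 := mul_nonneg hβ.le (sq_nonneg _)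
    have q4 := mul_pos (by linarith : 0 < L) q1
    nlinarith

theorem w_le (h : RescaledProfile a β c ω κ I p p' p'' w w' w'') {x : ℝ} (hx : 0 ≤ x) :
    w x ≤ ω := by
  have hω := h.ω_pos
  by_contra! hlt
  obtain ⟨r, hr, hK, hmax⟩ := exists_max_of_endpoint (f := w) h.cont_w
    (fun r h0 hrI => (h.out r h0 hrI).2)
    (by
      intro ε hε
      obtain ⟨M, hM, hMb⟩ := h.endpoint ε hε
      refine ⟨M, hM, fun r hr => ?_⟩
      linarith [(abs_lt.1 (hMb r hr).2).2])
    hx hlt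
  rcases hr with rfl | hr
  · have hB := h.w_zero_lt (mul_pos (by linarith) (h.pos_of_omega_le hK.le))
    obtain ⟨y, hy, hyI⟩ := (hB.and h.mem_nhdsGT_zero).exists
    have := hmax y (h.pos y hyI).le
    linarith
  · have hL := lap_nonpos_of_isLocalMax ((h.mem_nhds hr).mono h.deriv_w) (h.deriv_w' r hr)
      (h.isLocalMax_of_max hr hmax)
    rw [h.ode_w r hr] at hL
    have hP := h.p_pos r hr
    have hb := h.three_p_add_w_le (h.pos r hr).le
    have hpos := h.pos_of_omega_le hK.le
    generalize p r = P at *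
    generalize w r = V at *
    have hc := h.c_pos
    have hβ := h.β_pos
    have hrel := h.rel
    have hsup := h.sup
    rcases le_or_gt β (c * V) with hcV | hcV
    · nlinarith [mul_pos (hω.trans hK) hpos, mul_nonneg (sub_nonneg.2 hcV) (sq_nonneg P)]
    · have hPb : P ^ 2 ≤ ((4 * ω - V) / 3) ^ 2 := by
        apply pow_le_pow_left₀ hP.le; linarith
      have h1 := mul_nonneg (sub_nonneg.2 hPb) (sub_nonneg.2 hcV.le)
      obtain ⟨t, rfl⟩ : ∃ t, V = ω + t := ⟨V - ω, by ring⟩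
      have ht : 0 < t := by linarith
      obtain ⟨d, hd, rfl⟩ : ∃ d, 0 < d ∧ β = c * ω + d := ⟨β - c * ω, by linarith, by ring⟩
      have ha : a = 4 * c * ω ^ 2 - 2 * (c * ω + d) * ω := by linarith
      subst ha
      have : 0 < t * (6 * ω * d + 6 * c * ω ^ 2 + 2 * c * ω * t + 2 / 3 * d * t
          + 4 / 3 * c * t ^ 2) := by positivity
      nlinarith

theorem p_lt (h : RescaledProfile a β c ω κ I p p' p'' w w' w'') {x : ℝ} (hx : x ∈ I) :
    p x < ω := by
  have hω := h.ω_pos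
  have key : ∀ r ∈ I, ω ≤ p r → ¬ ∀ y, 0 ≤ y → p y ≤ p r := by
    intro r hr hle hmax
    have hL := lap_nonpos_of_isLocalMax ((h.mem_nhds hr).mono h.deriv_p) (h.deriv_p' r hr)
      (h.isLocalMax_of_max hr hmax)
    rw [h.ode_p r hr] at hL
    have hkp : 0 < κ / r ^ 2 * p r :=
      mul_pos (div_pos h.κ_pos (pow_pos (h.pos r hr) 2)) (h.p_pos r hr)
    have hw := h.w_le (h.pos r hr).le
    have hsup := h.sup
    have hrel := h.rel
    have hc := h.c_pos
    have h1 : 0 ≤ -a - 2 * β * w r + c * (3 * p r ^ 2 + w r ^ 2) := by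
      nlinarith [mul_nonneg (sub_nonneg.2 hw) (by nlinarith : 0 ≤ 2 * β - c * (w r + ω)),
        mul_nonneg hc.le (mul_nonneg (sub_nonneg.2 hle) (by linarith : 0 ≤ p r + ω))]
    have := mul_nonneg (h.p_pos r hr).le h1
    linarith
  have hle : ∀ y, 0 ≤ y → p y ≤ ω := by
    intro y hy
    by_contra! hlt
    obtain ⟨r, hr, hK, hmax⟩ := exists_max_of_endpoint (f := p) h.cont_p
      (fun r h0 hrI => (h.out r h0 hrI).1)
      (by
        intro ε hε
        obtain ⟨M, hM, hMb⟩ := h.endpoint ε hε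
        refine ⟨M, hM, fun r hr => ?_⟩
        linarith [(abs_lt.1 (hMb r hr).1).2])
      hy hlt
    rcases hr with rfl | hr
    · rw [h.p_zero] at hK
      linarith
    · exact key r hr hK.le hmax
  by_contra! hge
  exact key x hx hge fun y hy => (hle y hy).trans hge

theorem w_lt (h : RescaledProfile a β c ω κ I p p' p'' w w' w'') {x : ℝ} (hx : x = 0 ∨ x ∈ I) :
    w x < ω := by
  have hω := h.ω_pos
  by_contra! hge
  have hmax : ∀ y, 0 ≤ y → w y ≤ w x := fun y hy => (h.w_le hy).trans hge
  rcases hx with rfl | hx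
  · have hB := h.w_zero_lt (mul_pos (by linarith) (h.pos_of_omega_le hge))
    obtain ⟨y, hy, hyI⟩ := (hB.and h.mem_nhdsGT_zero).exists
    have := hmax y (h.pos y hyI).le
    linarith
  · have hL := lap_nonpos_of_isLocalMax ((h.mem_nhds hx).mono h.deriv_w) (h.deriv_w' x hx)
      (h.isLocalMax_of_max hx hmax)
    rw [h.ode_w x hx, le_antisymm (h.w_le (h.pos x hx).le) hge] at hL
    have hp := h.p_lt hx
    have hp0 := h.p_pos x hx
    have hrel := h.rel
    nlinarith [mul_pos (sub_pos.2 h.sup) (mul_pos (sub_pos.2 hp) (by linarith : 0 < ω + p x))]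

theorem p_lt' (h : RescaledProfile a β c ω κ I p p' p'' w w' w'') {x : ℝ} (hx : x = 0 ∨ x ∈ I) :
    p x < ω := by
  rcases hx with rfl | hx
  · rw [h.p_zero]
    exact h.ω_pos
  · exact h.p_lt hx

/-- Both functions are ordered on all pairs of radii `s ≤ r` whose midpoint is at least `l`. -/
def MonoFrom (p w : ℝ → ℝ) (l : ℝ) : Prop :=
  ∀ r s, 0 ≤ s → s ≤ r → 2 * l ≤ r + s → p s ≤ p r ∧ w s ≤ w r

theorem eventually_ordered {r s : ℝ} (hs : 0 < s) (hsr : s < r) :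
    ∀ᶠ z : ℝ × ℝ in 𝓝 (r, s), 0 ≤ z.2 ∧ z.2 ≤ z.1 := by
  have h1 : ∀ᶠ z : ℝ × ℝ in 𝓝 (r, s), 0 < z.2 :=
    continuousAt_snd.eventually_const_lt hs
  have h2 : ∀ᶠ z : ℝ × ℝ in 𝓝 (r, s), z.2 < z.1 :=
    continuousAt_snd.eventually_lt continuousAt_fst hsr
  filter_upwards [h1, h2] with z a b using ⟨a.le, b.le⟩

theorem p_strict (h : RescaledProfile a β c ω κ I p p' p'' w w' w'') {l r s : ℝ}
    (hl : MonoFrom p w l) (hs : s = 0 ∨ s ∈ I) (hsr : s < r) (hlrs : 2 * l ≤ r + s) :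
    p s < p r := by
  have hs0 : 0 ≤ s := hs.elim (fun e => e.ge) fun hs => (h.pos s hs).le
  have hr0 : 0 < r := hs0.trans_lt hsr
  by_cases hr : r ∈ I
  swap
  · rw [(h.out r hr0 hr).1]
    exact h.p_lt' hs
  rcases hs with rfl | hs
  · rw [h.p_zero]
    exact h.p_pos r hr
  by_contra! hge
  have heq : p s = p r := le_antisymm (hl r s hs0 hsr.le hlrs).1 hge
  have hs0' := h.pos s hs
  have hlap := lap_le_lap_of_two_point_min hs0' hr0 ((h.mem_nhds hr).mono h.deriv_p)
    ((h.mem_nhds hs).mono h.deriv_p) (h.deriv_p' r hr) (h.deriv_p' s hs) (by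
      filter_upwards [eventually_ordered hs0' hsr] with z hz hzs
      have := (hl z.1 z.2 hz.1 hz.2 (hlrs.trans hzs)).1
      linarith)
  rw [h.ode_p r hr, h.ode_p s hs, heq] at hlap
  have hp := h.p_pos r hr
  have hk : κ / r ^ 2 * p r < κ / s ^ 2 * p r := by
    apply mul_lt_mul_of_pos_right _ hp
    apply div_lt_div_of_pos_left h.κ_pos (by positivity)
    exact pow_lt_pow_left₀ hsr hs0 (by norm_num)
  have hww := (hl r s hs0 hsr.le hlrs).2
  have hwr := h.w_le hr0.le
  have hsup := h.sup
  have hc := h.c_pos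
  have h1 : 0 ≤ (w r - w s) * (2 * β - c * (w r + w s)) :=
    mul_nonneg (by linarith) (by nlinarith)
  have h2 := mul_nonneg hp.le h1
  nlinarith

theorem w_strict (h : RescaledProfile a β c ω κ I p p' p'' w w' w'') {l r s : ℝ}
    (hl : MonoFrom p w l) (hs : s = 0 ∨ s ∈ I) (hsr : s < r) (hlrs : 2 * l ≤ r + s) :
    w s < w r := by
  have hp := h.p_strict hl hs hsr hlrs
  have hs0 : 0 ≤ s := hs.elim (fun e => e.ge) fun hs => (h.pos s hs).le
  have hr0 : 0 < r := hs0.trans_lt hsr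
  by_cases hr : r ∈ I
  swap
  · rw [(h.out r hr0 hr).2]
    exact h.w_lt hs
  by_contra! hge
  have heq : w s = w r := le_antisymm (hl r s hs0 hsr.le hlrs).2 hge
  have hlt : w r * (-a + β * w r + c * (3 * p r ^ 2 + w r ^ 2)) - 3 * β * p r ^ 2 <
      w r * (-a + β * w r + c * (3 * p s ^ 2 + w r ^ 2)) - 3 * β * p s ^ 2 := by
    have h1 := h.w_le hr0.le
    have h2 : 0 < β - c * w r := by nlinarith [h.sup, h.c_pos]
    have h3 : 0 < p r + p s := by linarith [h.p_nonneg hs0]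
    nlinarith [mul_pos h2 (mul_pos (sub_pos.2 hp) h3)]
  rcases hs with rfl | hs
  · rw [h.p_zero] at hlt
    have hw0 : w 0 * (-a + β * w 0 + c * w 0 ^ 2) ≤ 0 := by
      by_contra! hpos
      obtain ⟨y, ⟨hy, hyr⟩, hy0⟩ :=
        (((h.w_zero_lt hpos).and (Ioo_mem_nhdsGT hr0)).and self_mem_nhdsWithin).exists
      have hy0' : 0 < y := hy0
      have := (hl r y hy0'.le hyr.2.le (by linarith)).2
      linarith
    have hlapneg : w'' r + w' r / r < 0 := by
      rw [h.ode_w r hr]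
      rw [heq] at hw0
      linarith
    have hright : ∀ᶠ y in 𝓝[>] r, w r ≤ w y := by
      filter_upwards [self_mem_nhdsWithin] with y hy
      have hy' : r < y := hy
      rw [← heq]
      exact (hl y 0 le_rfl (hr0.trans hy').le (by linarith)).2
    have hw1 : 0 ≤ w' r := deriv_nonneg_of_eventually_right_le (h.deriv_w r hr) hright
    have hd0 : HasDerivWithinAt w 0 (Ici 0) 0 := by
      obtain ⟨t, ht, htI⟩ := mem_nhdsGT_iff_exists_Ioo_subset.1 h.mem_nhdsGT_zero
      apply hasDerivWithinAt_Ici_of_tendsto_deriv (s := Ioo 0 t)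
      · exact fun y hy => (h.deriv_w y (htI hy)).differentiableAt.differentiableWithinAt
      · exact h.cont_w.continuousWithinAt
      · exact Ioo_mem_nhdsGT ht
      · apply h.w'_zero.congr'
        filter_upwards [h.mem_nhdsGT_zero] with y hy using (h.deriv_w y hy).deriv.symm
    have hw2 : w' r ≤ 0 := by
      by_contra! hpos
      have hd : HasDerivWithinAt (fun t => w (r - t) - w t) (-w' r) (Ici 0) 0 := by
        have e2 : HasDerivAt (fun t : ℝ => r - t) (-1) 0 := (hasDerivAt_id 0).const_sub r
        have c1 : HasDerivAt (fun t => w (r - t)) (w' r * (-1)) 0 :=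
          HasDerivAt.comp 0 (h₂ := w) (by simpa using h.deriv_w r hr) e2
        exact (c1.hasDerivWithinAt.sub hd0).congr_deriv (by ring)
      have hsub : Ioi (0 : ℝ) ⊆ Ici 0 \ {0} := fun y (hy : 0 < y) => ⟨hy.le, ne_of_gt hy⟩
      have hd' := (hasDerivWithinAt_iff_tendsto_slope.1 hd).mono_left (nhdsWithin_mono 0 hsub)
      obtain ⟨t, ⟨ht, ht0⟩, htr⟩ := ((hd'.eventually_lt_const (neg_neg_of_pos hpos)).and
        self_mem_nhdsWithin |>.and (Ioo_mem_nhdsGT (half_pos hr0))).exists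
      have ht0' : 0 < t := ht0
      rw [slope_def_field, sub_zero, sub_zero, heq, sub_self, sub_zero, div_lt_iff₀ ht0',
        zero_mul] at ht
      have := (hl (r - t) t ht0'.le (by linarith [htr.2]) (by linarith)).2
      linarith
    have hw3 : w' r = 0 := le_antisymm hw2 hw1
    rw [hw3, zero_div, add_zero] at hlapneg
    obtain ⟨y, hy1, hy2⟩ := ((eventually_right_lt_of_second_deriv_neg
      ((h.mem_nhds hr).mono h.deriv_w) (h.deriv_w' r hr) hw3 hlapneg).and hright).exists
    linarith
  · have hs0' := h.pos s hs
    have hlap := lap_le_lap_of_two_point_min hs0' hr0 ((h.mem_nhds hr).mono h.deriv_w)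
      ((h.mem_nhds hs).mono h.deriv_w) (h.deriv_w' r hr) (h.deriv_w' s hs) (by
        filter_upwards [eventually_ordered hs0' hsr] with z hz hzs
        have := (hl z.1 z.2 hz.1 hz.2 (hlrs.trans hzs)).2
        linarith)
    rw [h.ode_w r hr, h.ode_w s hs, heq] at hlap
    linarith

theorem deriv_nonneg_of_right_nonneg {f : ℝ → ℝ} {x m : ℝ} (hf : HasDerivAt f m x)
    (h0 : f x = 0) (h : ∀ᶠ y in 𝓝[>] x, 0 ≤ f y) : 0 ≤ m :=
  deriv_nonneg_of_eventually_right_le hf (h0 ▸ h)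

theorem p'_pos (h : RescaledProfile a β c ω κ I p p' p'' w w' w'') {l : ℝ} (hlI : l ∈ I)
    (hl : MonoFrom p w l) : 0 < p' l := by
  have hl0 := h.pos l hlI
  have hp : ∀ r ∈ I, l ≤ r → 0 ≤ p' r := fun r hr hlr =>
    deriv_nonneg_of_eventually_right_le (h.deriv_p r hr) (by
      filter_upwards [self_mem_nhdsWithin] with y hy
      have hy' : r < y := hy
      exact (hl y r (h.pos r hr).le hy'.le (by linarith)).1)
  have hw : 0 ≤ w' l :=
    deriv_nonneg_of_eventually_right_le (h.deriv_w l hlI) (by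
      filter_upwards [self_mem_nhdsWithin] with y hy
      have hy' : l < y := hy
      exact (hl y l hl0.le hy'.le (by linarith)).2)
  by_contra! hle
  have h0 : p' l = 0 := le_antisymm hle (hp l hlI le_rfl)
  have h2 : 0 ≤ p'' l := deriv_nonneg_of_right_nonneg (h.deriv_p' l hlI) h0 (by
    filter_upwards [self_mem_nhdsWithin, nhdsWithin_le_nhds (h.mem_nhds hlI)] with y hy hyI
    exact hp y hyI (le_of_lt hy))
  have dp := h.deriv_p l hlI
  have dw := h.deriv_w l hlI
  have d1 : HasDerivAt (fun r => κ / r ^ 2 * p r +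
      p r * (-a - 2 * β * w r + c * (3 * p r ^ 2 + w r ^ 2)) - p' r / r)
      (-2 * κ / l ^ 3 * p l + p l * (-2 * β * w' l + 2 * c * w l * w' l) - p'' l / l) l := by
    have e1 : HasDerivAt (fun r : ℝ => κ / r ^ 2) (-2 * κ / l ^ 3) l := by
      refine ((hasDerivAt_const l κ).div (hasDerivAt_pow 2 l) (by positivity)).congr_deriv ?_
      field_simp
      ring
    have e2 : HasDerivAt (fun r => -a - 2 * β * w r + c * (3 * p r ^ 2 + w r ^ 2))
        (-2 * β * w' l + 2 * c * w l * w' l) l := by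
      refine (((dw.const_mul (2 * β)).const_sub (-a)).add
        ((((dp.pow 2).const_mul 3).add (dw.pow 2)).const_mul c)).congr_deriv ?_
      rw [h0]
      ring
    refine (((e1.mul dp).add (dp.mul e2)).sub
      ((h.deriv_p' l hlI).div (hasDerivAt_id l) hl0.ne')).congr_deriv ?_
    simp only [h0, id]
    field_simp
    ring
  have d2 : HasDerivAt p''
      (-2 * κ / l ^ 3 * p l + p l * (-2 * β * w' l + 2 * c * w l * w' l) - p'' l / l) l := by
    apply d1.congr_of_eventuallyEq
    filter_upwards [h.mem_nhds hlI] with r hr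
    linarith [h.ode_p r hr]
  have hneg : -2 * κ / l ^ 3 * p l + p l * (-2 * β * w' l + 2 * c * w l * w' l) - p'' l / l < 0 := by
    have hpl := h.p_pos l hlI
    have hκ := h.κ_pos
    have q1 : 0 < κ / l ^ 3 * p l := by positivity
    have q2 : 0 ≤ p'' l / l := by positivity
    have q3 : 0 ≤ β - c * w l := by nlinarith [h.w_le hl0.le, h.sup, h.c_pos]
    have q4 := mul_nonneg hpl.le (mul_nonneg hw q3)
    have e : -2 * κ / l ^ 3 * p l = -2 * (κ / l ^ 3 * p l) := by ring
    rw [e]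
    linarith
  obtain ⟨t, ⟨ht, htl⟩, ht0⟩ := (((exists_reflection_lt_of_third_deriv_neg
    ((h.mem_nhds hlI).mono h.deriv_p) ((h.mem_nhds hlI).mono h.deriv_p') d2 h0 hneg).and
    (Ioo_mem_nhdsGT hl0)).and self_mem_nhdsWithin).exists
  have ht0' : 0 < t := ht0
  have := (hl (l + t) (l - t) (by linarith [htl.2]) (by linarith) (by linarith)).1
  linarith

theorem w'_pos (h : RescaledProfile a β c ω κ I p p' p'' w w' w'') {l : ℝ} (hlI : l ∈ I)
    (hl : MonoFrom p w l) : 0 < w' l := by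
  have hl0 := h.pos l hlI
  have hp := h.p'_pos hlI hl
  have hw : ∀ r ∈ I, l ≤ r → 0 ≤ w' r := fun r hr hlr =>
    deriv_nonneg_of_eventually_right_le (h.deriv_w r hr) (by
      filter_upwards [self_mem_nhdsWithin] with y hy
      have hy' : r < y := hy
      exact (hl y r (h.pos r hr).le hy'.le (by linarith)).2)
  by_contra! hle
  have h0 : w' l = 0 := le_antisymm hle (hw l hlI le_rfl)
  have h2 : 0 ≤ w'' l := deriv_nonneg_of_right_nonneg (h.deriv_w' l hlI) h0 (by
    filter_upwards [self_mem_nhdsWithin, nhdsWithin_le_nhds (h.mem_nhds hlI)] with y hy hyI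
    exact hw y hyI (le_of_lt hy))
  have dp := h.deriv_p l hlI
  have dw := h.deriv_w l hlI
  have d1 : HasDerivAt (fun r =>
      w r * (-a + β * w r + c * (3 * p r ^ 2 + w r ^ 2)) - 3 * β * p r ^ 2 - w' r / r)
      (6 * p l * p' l * (c * w l - β) - w'' l / l) l := by
    have e2 : HasDerivAt (fun r => -a + β * w r + c * (3 * p r ^ 2 + w r ^ 2))
        (6 * c * p l * p' l) l := by
      refine (((dw.const_mul β).const_add (-a)).add
        ((((dp.pow 2).const_mul 3).add (dw.pow 2)).const_mul c)).congr_deriv ?_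
      rw [h0]
      ring
    refine (((dw.mul e2).sub ((dp.pow 2).const_mul (3 * β))).sub
      ((h.deriv_w' l hlI).div (hasDerivAt_id l) hl0.ne')).congr_deriv ?_
    simp only [h0, id]
    field_simp
    ring
  have d2 : HasDerivAt w'' (6 * p l * p' l * (c * w l - β) - w'' l / l) l := by
    apply d1.congr_of_eventuallyEq
    filter_upwards [h.mem_nhds hlI] with r hr
    linarith [h.ode_w r hr]
  have hneg : 6 * p l * p' l * (c * w l - β) - w'' l / l < 0 := by
    have hpl := h.p_pos l hlI
    have q2 : 0 ≤ w'' l / l := by positivity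
    have q3 : 0 < β - c * w l := by nlinarith [h.w_le hl0.le, h.sup, h.c_pos]
    have q4 := mul_pos (mul_pos hpl hp) q3
    linarith
  obtain ⟨t, ⟨ht, htl⟩, ht0⟩ := (((exists_reflection_lt_of_third_deriv_neg
    ((h.mem_nhds hlI).mono h.deriv_w) ((h.mem_nhds hlI).mono h.deriv_w') d2 h0 hneg).and
    (Ioo_mem_nhdsGT hl0)).and self_mem_nhdsWithin).exists
  have ht0' : 0 < t := ht0
  have := (hl (l + t) (l - t) (by linarith [htl.2]) (by linarith) (by linarith)).2
  linarith

theorem exists_pos_near (h : RescaledProfile a β c ω κ I p p' p'' w w' w'') :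
    ∃ ε > 0, ∀ p₁ p₂ w₁ w₂ : ℝ, |p₁ - ω| < ε → |p₂ - ω| < ε → |w₁ - ω| < ε → |w₂ - ω| < ε →
      0 < (-a - 2 * β * w₁ + 3 * c * (p₁ ^ 2 + p₁ * p₂ + p₂ ^ 2) + c * w₁ ^ 2)
        + p₂ * (c * (w₁ + w₂) - 2 * β) ∧
      0 < (p₁ + p₂) * (3 * c * w₁ - 3 * β)
        + (-a + β * (w₁ + w₂) + 3 * c * p₂ ^ 2 + c * (w₁ ^ 2 + w₁ * w₂ + w₂ ^ 2)) := by
  have hpos : 0 < 8 * c * ω ^ 2 - 2 * β * ω := by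
    nlinarith [mul_nonneg h.ω_pos.le (sub_nonneg.2 h.β_le), mul_pos h.c_pos (pow_pos h.ω_pos 2)]
  have hrel := h.rel
  have h1 : ∀ᶠ z : ℝ × ℝ × ℝ × ℝ in 𝓝 (ω, ω, ω, ω),
      0 < (-a - 2 * β * z.2.2.1 + 3 * c * (z.1 ^ 2 + z.1 * z.2.1 + z.2.1 ^ 2) + c * z.2.2.1 ^ 2)
        + z.2.1 * (c * (z.2.2.1 + z.2.2.2) - 2 * β) := by
    apply ContinuousAt.eventually_lt continuousAt_const (by fun_prop)
    nlinarith
  have h2 : ∀ᶠ z : ℝ × ℝ × ℝ × ℝ in 𝓝 (ω, ω, ω, ω),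
      0 < (z.1 + z.2.1) * (3 * c * z.2.2.1 - 3 * β)
        + (-a + β * (z.2.2.1 + z.2.2.2) + 3 * c * z.2.1 ^ 2
          + c * (z.2.2.1 ^ 2 + z.2.2.1 * z.2.2.2 + z.2.2.2 ^ 2)) := by
    apply ContinuousAt.eventually_lt continuousAt_const (by fun_prop)
    nlinarith
  obtain ⟨ε, hε, hb⟩ := Metric.eventually_nhds_iff.1 (h1.and h2)
  refine ⟨ε, hε, fun p₁ p₂ w₁ w₂ a1 a2 a3 a4 => ?_⟩
  exact hb (y := (p₁, p₂, w₁, w₂)) (by simp [Prod.dist_eq, Real.dist_eq, a1, a2, a3, a4])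

theorem exists_lt_bound (h : RescaledProfile a β c ω κ I p p' p'' w w' w'') {M : ℝ} (hM : M ∈ I) :
    ∃ K < ω, ∀ s ∈ Icc 0 M, p s ≤ K ∧ w s ≤ K := by
  have hne : (Icc 0 M).Nonempty := ⟨0, le_rfl, (h.pos M hM).le⟩
  have hc : Continuous fun s => max (p s) (w s) := h.cont_p.max h.cont_w
  obtain ⟨x, hx, hmax⟩ := isCompact_Icc.exists_isMaxOn hne hc.continuousOn
  refine ⟨max (p x) (w x), ?_, fun s hs => max_le_iff.1 (hmax hs)⟩
  have hx' : x = 0 ∨ x ∈ I := hx.1.eq_or_lt.imp Eq.symm fun h0 => h.down M hM x h0 hx.2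
  exact max_lt (h.p_lt' hx') (h.w_lt hx')

theorem exists_monoFrom (h : RescaledProfile a β c ω κ I p p' p'' w w' w'') :
    ∃ l ∈ I, MonoFrom p w l := by
  obtain ⟨ε, hε, hnear⟩ := h.exists_pos_near
  obtain ⟨M₀, hM₀, hM₀b⟩ := h.endpoint ε hε
  obtain ⟨K, hK, hKb⟩ := h.exists_lt_bound hM₀
  obtain ⟨M₁, hM₁, hM₁b⟩ := h.endpoint (ω - K) (by linarith)
  refine ⟨max M₀ M₁, by rcases max_choice M₀ M₁ with e | e <;> rw [e] <;> assumption, ?_⟩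
  intro r₀ s₀ hs₀ hsr₀ hl₀
  by_contra hneg
  set F : ℝ × ℝ → ℝ := fun z => min (p z.1 - p z.2) (w z.1 - w z.2) with hF
  have hFc : Continuous F := by
    have := h.cont_p
    have := h.cont_w
    fun_prop
  have hF₀ : F (r₀, s₀) < 0 := by
    rw [not_and_or, not_le, not_le] at hneg
    exact min_lt_iff.2 (hneg.imp sub_neg.2 sub_neg.2)
  obtain ⟨M₂, hM₂, hM₂b⟩ := h.endpoint (-F (r₀, s₀)) (by linarith)
  set T : Set (ℝ × ℝ) := {z | 0 ≤ z.2 ∧ z.2 ≤ z.1 ∧ 2 * max M₀ M₁ ≤ z.1 + z.2} with hT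
  have hTc : IsClosed T :=
    (isClosed_le continuous_const continuous_snd).inter
      ((isClosed_le continuous_snd continuous_fst).inter
        (isClosed_le continuous_const (continuous_fst.add continuous_snd)))
  have hcomp : IsCompact ((Icc 0 (max M₂ r₀) ×ˢ Icc 0 (max M₂ r₀)) ∩ T) :=
    (isCompact_Icc.prod isCompact_Icc).inter_right hTc
  have hr₀T : (r₀, s₀) ∈ T := ⟨hs₀, hsr₀, hl₀⟩
  obtain ⟨⟨r, s⟩, hrs, hmin⟩ := hcomp.exists_isMinOn
    ⟨(r₀, s₀), ⟨⟨hs₀.trans hsr₀, le_max_right _ _⟩, ⟨hs₀, hsr₀.trans (le_max_right _ _)⟩⟩, hr₀T⟩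
    hFc.continuousOn
  have hm₀ : F (r, s) ≤ F (r₀, s₀) :=
    hmin ⟨⟨⟨hs₀.trans hsr₀, le_max_right _ _⟩, ⟨hs₀, hsr₀.trans (le_max_right _ _)⟩⟩, hr₀T⟩
  have hm : F (r, s) < 0 := hm₀.trans_lt hF₀
  have hglob : ∀ z ∈ T, F (r, s) ≤ F z := by
    intro z hz
    have hz1 : 0 ≤ z.1 := hz.1.trans hz.2.1
    by_cases hzM : z.1 ≤ max M₂ r₀
    · exact hmin ⟨⟨⟨hz1, hzM⟩, ⟨hz.1, hz.2.1.trans hzM⟩⟩, hz⟩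
    · have hb := hM₂b z.1 ((le_max_left _ _).trans (not_le.1 hzM).le)
      rw [abs_lt, abs_lt] at hb
      have hps : p z.2 ≤ ω := by
        rcases hz.1.eq_or_lt with e | e
        · exact (h.p_lt' (Or.inl e.symm)).le
        · by_cases hI : z.2 ∈ I
          · exact (h.p_lt hI).le
          · exact (h.out _ e hI).1.le
      have hws := h.w_le hz.1
      exact hm₀.trans (le_min (by linarith [hb.1.1]) (by linarith [hb.2.1]))
  obtain ⟨hs, hsr, hl⟩ : 0 ≤ s ∧ s ≤ r ∧ 2 * max M₀ M₁ ≤ r + s := hrs.2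
  have hM₀r : M₀ ≤ r := by linarith [le_max_left M₀ M₁]
  have hM₁r : M₁ ≤ r := by linarith [le_max_right M₀ M₁]
  have hM₀s : M₀ < s := by
    by_contra! hle
    have hb := hM₁b r hM₁r
    rw [abs_lt, abs_lt] at hb
    have hk := hKb s ⟨hs, hle⟩
    exact hm.not_ge (le_min (by linarith [hb.1.1]) (by linarith [hb.2.1]))
  have hs0 : 0 < s := (h.pos _ hM₀).trans hM₀s
  have hsr' : s < r := by
    refine hsr.lt_of_ne fun e => ?_
    subst e
    simp [hF] at hm
  have hr0 : 0 < r := hs0.trans hsr'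
  have hrI : r ∈ I := by
    by_contra hrI
    have hout := h.out r hr0 hrI
    apply hm.not_ge
    have hws := h.w_le hs
    have hps : p s ≤ ω := by
      by_cases hI : s ∈ I
      · exact (h.p_lt hI).le
      · exact (h.out _ hs0 hI).1.le
    exact le_min (by linarith [hout.1]) (by linarith [hout.2])
  have hsI : s ∈ I := h.down r hrI s hs0 hsr
  obtain ⟨hα, hη⟩ := hnear (p r) (p s) (w r) (w s) (hM₀b r hM₀r).1 (hM₀b s hM₀s.le).1
    (hM₀b r hM₀r).2 (hM₀b s hM₀s.le).2
  have hγ : p s * (c * (w r + w s) - 2 * β) ≤ 0 := by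
    apply mul_nonpos_of_nonneg_of_nonpos (h.p_pos s hsI).le
    nlinarith [h.w_le hs, h.w_le hr0.le, h.sup, h.c_pos]
  have hδ : (p r + p s) * (3 * c * w r - 3 * β) ≤ 0 := by
    apply mul_nonpos_of_nonneg_of_nonpos (add_pos (h.p_pos r hrI) (h.p_pos s hsI)).le
    nlinarith [h.w_le hr0.le, h.sup, h.c_pos]
  have hnhds : ∀ᶠ z : ℝ × ℝ in 𝓝 (r, s), r + s ≤ z.1 + z.2 → F (r, s) ≤ F z := by
    filter_upwards [eventually_ordered hs0 hsr'] with z hz hzs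
    exact hglob z ⟨hz.1, hz.2, hl.trans hzs⟩
  rcases le_total (p r - p s) (w r - w s) with hle | hle
  · have hFeq : F (r, s) = p r - p s := min_eq_left hle
    rw [hFeq] at hm hnhds
    have hlap := lap_le_lap_of_two_point_min hs0 hr0 ((h.mem_nhds hrI).mono h.deriv_p)
      ((h.mem_nhds hsI).mono h.deriv_p) (h.deriv_p' r hrI) (h.deriv_p' s hsI)
      (hnhds.mono fun z hz hzs => (hz hzs).trans (min_le_left _ _))
    rw [h.ode_p r hrI, h.ode_p s hsI] at hlap
    have hk : κ / r ^ 2 * p r ≤ κ / s ^ 2 * p s := by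
      apply mul_le_mul _ (by linarith) (h.p_pos r hrI).le (div_nonneg h.κ_pos.le (sq_nonneg s))
      exact div_le_div_of_nonneg_left h.κ_pos.le (by positivity) (pow_le_pow_left₀ hs hsr 2)
    nlinarith [mul_nonneg (neg_nonneg.2 hγ) (sub_nonneg.2 hle), mul_pos hα (neg_pos.2 hm)]
  · have hFeq : F (r, s) = w r - w s := min_eq_right hle
    rw [hFeq] at hm hnhds
    have hlap := lap_le_lap_of_two_point_min hs0 hr0 ((h.mem_nhds hrI).mono h.deriv_w)
      ((h.mem_nhds hsI).mono h.deriv_w) (h.deriv_w' r hrI) (h.deriv_w' s hsI)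
      (hnhds.mono fun z hz hzs => (hz hzs).trans (min_le_right _ _))
    rw [h.ode_w r hrI, h.ode_w s hsI] at hlap
    nlinarith [mul_nonneg (neg_nonneg.2 hδ) (sub_nonneg.2 hle), mul_pos hη (neg_pos.2 hm)]

theorem monoFrom_of_forall_gt (h : RescaledProfile a β c ω κ I p p' p'' w w' w'') {l : ℝ}
    (hl : ∀ l' > l, MonoFrom p w l') : MonoFrom p w l := by
  intro r s hs hsr hlrs
  have key : ∀ᶠ t in 𝓝[>] r, p s ≤ p t ∧ w s ≤ w t := by
    filter_upwards [self_mem_nhdsWithin] with t ht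
    have ht' : r < t := ht
    exact hl ((t + s) / 2) (show l < (t + s) / 2 by linarith) t s hs (hsr.trans ht'.le)
      (by linarith)
  exact ⟨ge_of_tendsto (h.cont_p.continuousAt.mono_left nhdsWithin_le_nhds)
      (key.mono fun _ hx => hx.1),
    ge_of_tendsto (h.cont_w.continuousAt.mono_left nhdsWithin_le_nhds)
      (key.mono fun _ hx => hx.2)⟩

theorem strictMonoOn_near {f f' : ℝ → ℝ} {x : ℝ} (hf : ∀ᶠ y in 𝓝 x, HasDerivAt f (f' y) y)
    (hc : ContinuousAt f' x) (hpos : 0 < f' x) :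
    ∃ δ > 0, StrictMonoOn f (Ioo (x - δ) (x + δ)) := by
  obtain ⟨δ, hδ, hb⟩ := Metric.eventually_nhds_iff_ball.1
    (hf.and (hc.eventually_const_lt hpos))
  rw [Real.ball_eq_Ioo] at hb
  refine ⟨δ, hδ, strictMonoOn_of_deriv_pos (convex_Ioo _ _)
    (fun y hy => (hb y hy).1.continuousAt.continuousWithinAt) fun y hy => ?_⟩
  rw [interior_Ioo] at hy
  rw [(hb y hy).1.deriv]
  exact (hb y hy).2

theorem eventually_ordered_diag {f : ℝ → ℝ} {x δ : ℝ} (hδ : 0 < δ)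
    (hf : StrictMonoOn f (Ioo (x - δ) (x + δ))) :
    ∀ᶠ z : ℝ × ℝ in 𝓝 (2 * x, x), z.2 ≤ z.1 - z.2 → f z.2 ≤ f (z.1 - z.2) := by
  have h1 : ∀ᶠ z : ℝ × ℝ in 𝓝 (2 * x, x), z.2 ∈ Ioo (x - δ) (x + δ) :=
    continuousAt_snd.eventually (Ioo_mem_nhds (by simp [hδ]) (by simp [hδ]))
  have h2 : ∀ᶠ z : ℝ × ℝ in 𝓝 (2 * x, x), z.1 - z.2 ∈ Ioo (x - δ) (x + δ) :=
    (continuousAt_fst.sub continuousAt_snd).eventually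
      (Ioo_mem_nhds (by simp; linarith) (by simp; linarith))
  filter_upwards [h1, h2] with z hz1 hz2 hle using hf.monotoneOn hz1 hz2 hle

theorem exists_lt_monoFrom (h : RescaledProfile a β c ω κ I p p' p'' w w' w'') {l : ℝ}
    (hlI : l ∈ I) (hl : MonoFrom p w l) : ∃ l', 0 < l' ∧ l' < l ∧ MonoFrom p w l' := by
  have hl0 := h.pos l hlI
  obtain ⟨δp, hδp, hmp⟩ := strictMonoOn_near ((h.mem_nhds hlI).mono h.deriv_p)
    (h.deriv_p' l hlI).continuousAt (h.p'_pos hlI hl)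
  obtain ⟨δw, hδw, hmw⟩ := strictMonoOn_near ((h.mem_nhds hlI).mono h.deriv_w)
    (h.deriv_w' l hlI).continuousAt (h.w'_pos hlI hl)
  have hev : ∀ᶠ σ in 𝓝 (2 * l), ∀ s ∈ Icc 0 l,
      s ≤ σ - s → p s ≤ p (σ - s) ∧ w s ≤ w (σ - s) := by
    apply isCompact_Icc.eventually_forall_of_forall_eventually
      (P := fun σ s => s ≤ σ - s → p s ≤ p (σ - s) ∧ w s ≤ w (σ - s))
    intro s hs
    rcases hs.2.eq_or_lt with rfl | hsl
    · filter_upwards [eventually_ordered_diag hδp hmp, eventually_ordered_diag hδw hmw]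
        with z h1 h2 hz using ⟨h1 hz, h2 hz⟩
    · have hs' : s = 0 ∨ s ∈ I := hs.1.eq_or_lt.imp Eq.symm fun h0 => h.down l hlI s h0 hs.2
      have hp := h.p_strict hl hs' (r := 2 * l - s) (by linarith) (by linarith)
      have hw := h.w_strict hl hs' (r := 2 * l - s) (by linarith) (by linarith)
      have cp := h.cont_p
      have cw := h.cont_w
      have e1 : ∀ᶠ z : ℝ × ℝ in 𝓝 (2 * l, s), p z.2 < p (z.1 - z.2) :=
        ContinuousAt.eventually_lt (by fun_prop) (by fun_prop) hp
      have e2 : ∀ᶠ z : ℝ × ℝ in 𝓝 (2 * l, s), w z.2 < w (z.1 - z.2) :=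
        ContinuousAt.eventually_lt (by fun_prop) (by fun_prop) hw
      filter_upwards [e1, e2] with z h1 h2 _ using ⟨h1.le, h2.le⟩
  obtain ⟨ε, hε, hb⟩ := Metric.eventually_nhds_iff.1 hev
  refine ⟨l - min (ε / 4) (l / 2), ?_, ?_, ?_⟩
  · linarith [min_le_right (ε / 4) (l / 2)]
  · linarith [lt_min (by linarith : 0 < ε / 4) (by linarith : 0 < l / 2)]
  · intro r s hs hsr hlrs
    by_cases hbig : 2 * l ≤ r + s
    · exact hl r s hs hsr hbig
    · have := hb (y := r + s) (by
        rw [Real.dist_eq, abs_lt]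
        constructor <;> linarith [min_le_left (ε / 4) (l / 2)]) s ⟨hs, by linarith⟩ (by linarith)
      simpa using this

theorem monoFrom_of_pos (h : RescaledProfile a β c ω κ I p p' p'' w w' w'') {l : ℝ}
    (hl : 0 < l) : MonoFrom p w l := by
  obtain ⟨l₀, hl₀I, hl₀⟩ := h.exists_monoFrom
  set Λ : Set ℝ := {l | 0 < l ∧ MonoFrom p w l} with hΛ
  have hne : Λ.Nonempty := ⟨l₀, h.pos l₀ hl₀I, hl₀⟩
  have hbdd : BddBelow Λ := ⟨0, fun x hx => hx.1.le⟩
  have hgt : ∀ l' > sInf Λ, MonoFrom p w l' := by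
    intro l' hl'
    obtain ⟨x, hx, hxl⟩ := (csInf_lt_iff hbdd hne).1 hl'
    exact fun r s hs hsr hlrs => hx.2 r s hs hsr (by linarith)
  apply hgt
  by_contra! hle
  have hpos : 0 < sInf Λ := hl.trans_le hle
  have hmem : sInf Λ ∈ I :=
    h.down l₀ hl₀I _ hpos (csInf_le hbdd ⟨h.pos l₀ hl₀I, hl₀⟩)
  obtain ⟨l', hl'0, hl'lt, hl'⟩ := h.exists_lt_monoFrom hmem (h.monoFrom_of_forall_gt hgt)
  exact (csInf_le hbdd ⟨hl'0, hl'⟩).not_gt hl'lt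

theorem deriv_pos (h : RescaledProfile a β c ω κ I p p' p'' w w' w'') {r : ℝ} (hr : r ∈ I) :
    0 < p' r ∧ 0 < w' r :=
  have hm := h.monoFrom_of_pos (h.pos r hr)
  ⟨h.p'_pos hr hm, h.w'_pos hr hm⟩

end RescaledProfile

theorem isOpen_Iset (R : ℝ≥0∞) : IsOpen (Iset R) :=
  (isOpen_lt continuous_const continuous_id).inter
    (isOpen_lt ENNReal.continuous_ofReal continuous_const)

theorem Iset_down {R : ℝ≥0∞} {s t : ℝ} (hs : s ∈ Iset R) (ht : 0 < t) (hts : t ≤ s) :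
    t ∈ Iset R :=
  ⟨ht, (ENNReal.ofReal_le_ofReal hts).trans_lt hs.2⟩

theorem Iset_mem_nhdsGT_zero {R : ℝ≥0∞} (hR : 0 < R) : ∀ᶠ r in 𝓝[>] (0 : ℝ), r ∈ Iset R := by
  have h : ∀ᶠ r in 𝓝 (0 : ℝ), ENNReal.ofReal r < R :=
    ENNReal.continuous_ofReal.continuousAt.eventually_lt continuousAt_const (by simpa using hR)
  filter_upwards [self_mem_nhdsWithin, nhdsWithin_le_nhds h] with r h0 hr using ⟨h0, hr⟩

theorem exists_mem_Iset_of_eventually_endFilter {R : ℝ≥0∞} (hR : 0 < R) {P : ℝ → Prop}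
    (h : ∀ᶠ r in endFilter R, P r) : ∃ M ∈ Iset R, ∀ r ≥ M, r ∈ Iset R → P r := by
  by_cases hT : R = ⊤
  · rw [endFilter, if_pos hT] at h
    obtain ⟨M, hM⟩ := eventually_atTop.1 h
    exact ⟨max M 1, ⟨by positivity, by simp [hT]⟩, fun r hr _ => hM r ((le_max_left _ _).trans hr)⟩
  · rw [endFilter, if_neg hT] at h
    have hpos : 0 < R.toReal := ENNReal.toReal_pos hR.ne' hT
    obtain ⟨M, hM, hMb⟩ := mem_nhdsLT_iff_exists_Ioo_subset.1 h
    have hM' : M < R.toReal := hM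
    have hmem : ∀ r, 0 < r → (r ∈ Iset R ↔ r < R.toReal) := fun r hr =>
      ⟨fun hr' => (ENNReal.ofReal_lt_iff_lt_toReal hr.le hT).1 hr'.2,
        fun hr' => ⟨hr, (ENNReal.ofReal_lt_iff_lt_toReal hr.le hT).2 hr'⟩⟩
    obtain ⟨N, hN1, hN2⟩ := exists_between (max_lt hM' hpos)
    have hN0 : 0 < N := (le_max_right _ _).trans_lt hN1
    refine ⟨N, (hmem N hN0).2 hN2, fun r hr hrI => hMb ⟨?_, (hmem r hrI.1).1 hrI⟩⟩
    exact ((le_max_left _ _).trans_lt hN1).trans_le hr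

open Classical in
/-- Extension of a function on `(0, R)` to `ℝ` by the constants `A` on the left and `B` on the
right. -/
def extendConst (R : ℝ≥0∞) (A B : ℝ) (f : ℝ → ℝ) (r : ℝ) : ℝ :=
  if r ≤ 0 then A else if r ∈ Iset R then f r else B

theorem extendConst_of_mem {R : ℝ≥0∞} {A B : ℝ} {f : ℝ → ℝ} {r : ℝ} (hr : r ∈ Iset R) :
    extendConst R A B f r = f r := by
  rw [extendConst, if_neg (not_le.2 hr.1), if_pos hr]

theorem extendConst_of_notMem {R : ℝ≥0∞} {A B : ℝ} {f : ℝ → ℝ} {r : ℝ} (h0 : 0 < r)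
    (hr : r ∉ Iset R) : extendConst R A B f r = B := by
  rw [extendConst, if_neg (not_le.2 h0), if_neg hr]

theorem extendConst_of_nonpos {R : ℝ≥0∞} {A B : ℝ} {f : ℝ → ℝ} {r : ℝ} (h0 : r ≤ 0) :
    extendConst R A B f r = A := by
  rw [extendConst, if_pos h0]

theorem extendConst_endpoint {R : ℝ≥0∞} (hR : 0 < R) {A B : ℝ} {f : ℝ → ℝ}
    (hB : Tendsto f (endFilter R) (𝓝 B)) {U : Set ℝ} (hU : U ∈ 𝓝 B) :
    ∃ M ∈ Iset R, ∀ r ≥ M, extendConst R A B f r ∈ U := by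
  obtain ⟨M, hM, hMb⟩ := exists_mem_Iset_of_eventually_endFilter hR (hB.eventually hU)
  refine ⟨M, hM, fun r hr => ?_⟩
  by_cases hrI : r ∈ Iset R
  · rw [extendConst_of_mem hrI]
    exact hMb r hr hrI
  · rw [extendConst_of_notMem (hM.1.trans_le hr) hrI]
    exact mem_of_mem_nhds hU

theorem continuous_extendConst {R : ℝ≥0∞} (hR : 0 < R) {A B : ℝ} {f : ℝ → ℝ}
    (hf : ContinuousOn f (Iset R)) (hA : Tendsto f (𝓝[>] 0) (𝓝 A))
    (hB : Tendsto f (endFilter R) (𝓝 B)) : Continuous (extendConst R A B f) := by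
  rw [continuous_iff_continuousAt]
  intro r
  rcases lt_trichotomy r 0 with hr | rfl | hr
  · apply (continuousAt_const (y := A)).congr
    filter_upwards [Iio_mem_nhds hr] with y hy
    exact (extendConst_of_nonpos (le_of_lt hy)).symm
  · rw [continuousAt_iff_continuous_left'_right', ContinuousWithinAt, ContinuousWithinAt,
      extendConst_of_nonpos le_rfl]
    constructor
    · apply tendsto_const_nhds.congr'
      filter_upwards [self_mem_nhdsWithin] with y hy
      exact (extendConst_of_nonpos (le_of_lt hy)).symm
    · apply hA.congr'
      filter_upwards [Iset_mem_nhdsGT_zero hR] with y hy using (extendConst_of_mem hy).symm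
  · by_cases hrI : r ∈ Iset R
    · apply (hf.continuousAt ((isOpen_Iset R).mem_nhds hrI)).congr
      filter_upwards [(isOpen_Iset R).mem_nhds hrI] with y hy using (extendConst_of_mem hy).symm
    · intro U hU
      rw [extendConst_of_notMem hr hrI] at hU
      obtain ⟨M, hM, hMb⟩ := extendConst_endpoint (A := A) hR hB hU
      have hMr : M < r := by
        by_contra! hle
        exact hrI (Iset_down hM hr hle)
      rw [mem_map]
      filter_upwards [Ioi_mem_nhds hMr] with y hy using hMb y (le_of_lt hy)

theorem exists_tendsto_nhdsGT_zero_of_tendsto_deriv {f : ℝ → ℝ}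
    (hf : ∀ᶠ r in 𝓝[>] (0 : ℝ), DifferentiableAt ℝ f r)
    (h : Tendsto (deriv f) (𝓝[>] 0) (𝓝 0)) : ∃ A, Tendsto f (𝓝[>] 0) (𝓝 A) := by
  have hb : ∀ᶠ r in 𝓝[>] (0 : ℝ), ‖deriv f r‖₊ ≤ 1 := by
    filter_upwards [h.norm.eventually_lt_const (u := 1) (by simp)] with r hr
    exact hr.le
  obtain ⟨δ, hδ, hall⟩ := mem_nhdsGT_iff_exists_Ioo_subset.1 (hf.and hb)
  have hlip : LipschitzOnWith 1 f (Ioo 0 δ) :=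
    (convex_Ioo 0 δ).lipschitzOnWith_of_nnnorm_deriv_le (fun x hx => (hall hx).1)
      fun x hx => (hall hx).2
  obtain ⟨g, hg, hfg⟩ := hlip.extend_real
  refine ⟨g 0, (hg.continuous.continuousAt.mono_left nhdsWithin_le_nhds).congr' ?_⟩
  filter_upwards [Ioo_mem_nhdsGT hδ] with r hr using (hfg hr).symm

theorem hasDerivAt_deriv_of_contDiffOn_two {f : ℝ → ℝ} {I : Set ℝ} (hI : IsOpen I)
    (hf : ContDiffOn ℝ 2 f I) {r : ℝ} (hr : r ∈ I) :
    HasDerivAt f (deriv f r) r ∧ HasDerivAt (deriv f) (deriv (deriv f) r) r := by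
  have h1 : ContDiffOn ℝ 1 (deriv f) I := hf.deriv_of_isOpen hI (by norm_num)
  exact ⟨((hf.differentiableOn (by norm_num)).differentiableAt (hI.mem_nhds hr)).hasDerivAt,
    ((h1.differentiableOn (by norm_num)).differentiableAt (hI.mem_nhds hr)).hasDerivAt⟩

theorem ProfileSolution.exists_rescaledProfile {a2 b2 c2 : ℝ} (ha : 0 ≤ a2) (hb : 0 < b2)
    (hc : 0 < c2) (hsup : 3 * a2 * c2 < b2 ^ 2) {k : ℤ} (hk : k ≠ 0) {R : ℝ≥0∞} (hR : 0 < R)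
    {u v : ℝ → ℝ} (hsol : ProfileSolution a2 b2 c2 k R u v) (hu : ∀ r ∈ Iset R, 0 < u r) :
    ∃ p w, RescaledProfile a2 (b2 / √6) c2 (sPlus a2 b2 c2 / √6) ((k : ℝ) ^ 2) (Iset R)
      p (fun r => deriv u r / √3) (fun r => deriv (deriv u) r / √3)
      w (fun r => -deriv v r) (fun r => -deriv (deriv v) r) := by
  have hI := isOpen_Iset R
  have hdu := fun r hr => hasDerivAt_deriv_of_contDiffOn_two hI hsol.smooth_u (r := r) hr
  have hdv := fun r hr => hasDerivAt_deriv_of_contDiffOn_two hI hsol.smooth_v (r := r) hr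
  obtain ⟨A, hA⟩ := exists_tendsto_nhdsGT_zero_of_tendsto_deriv
    ((Iset_mem_nhdsGT_zero hR).mono fun r hr => (hdv r hr).1.differentiableAt) hsol.bc0_v
  set ω := sPlus a2 b2 c2 / √6 with hω
  have h3 : (√3 : ℝ) ^ 2 = 3 := Real.sq_sqrt (by norm_num)
  have h6 : (√6 : ℝ) ^ 2 = 6 := Real.sq_sqrt (by norm_num)
  have h3p : 0 < √(3 : ℝ) := by positivity
  have h6p : 0 < √(6 : ℝ) := by positivity
  have h2p : 0 < √(2 : ℝ) := by positivity
  have h63 : (√6 : ℝ) = √2 * √3 := by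
    rw [← Real.sqrt_mul (by norm_num)]
    norm_num
  set S := √(b2 ^ 2 + 24 * a2 * c2) with hS
  have hS2 : S ^ 2 = b2 ^ 2 + 24 * a2 * c2 := Real.sq_sqrt (by positivity)
  have hS0 : 0 ≤ S := Real.sqrt_nonneg _
  have hs : sPlus a2 b2 c2 = (b2 + S) / (4 * c2) := rfl
  have hspos : 0 < sPlus a2 b2 c2 := by
    rw [hs]
    positivity
  have hSlt : S < 3 * b2 := by nlinarith
  have hcs : 4 * c2 * sPlus a2 b2 c2 = b2 + S := by
    rw [hs]
    field_simp
  have hBu : Tendsto (fun r => u r / √3) (endFilter R) (𝓝 ω) := by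
    have : ω = sPlus a2 b2 c2 / √2 / √3 := by rw [hω, h63, div_div]
    rw [this]
    exact hsol.bcR_u.div_const _
  have hBv : Tendsto (fun r => -v r) (endFilter R) (𝓝 ω) := by
    simpa using hsol.bcR_v.neg
  have hAu : Tendsto (fun r => u r / √3) (𝓝[>] 0) (𝓝 0) := by
    simpa using hsol.bc0_u.div_const (√3)
  refine ⟨extendConst R 0 ω fun r => u r / √3, extendConst R (-A) ω fun r => -v r, ?_⟩
  have heq : ∀ r ∈ Iset R, ∀ B f, extendConst R B ω f =ᶠ[𝓝 r] f := by
    intro r hr B f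
    filter_upwards [hI.mem_nhds hr] with y hy using extendConst_of_mem hy
  exact
  { a_nonneg := ha
    c_pos := hc
    ω_pos := div_pos hspos h6p
    κ_pos := by positivity
    rel := by
      rw [hω]
      field_simp
      rw [h6]
      nlinarith
    sup := by
      rw [hω, ← mul_div_assoc]
      gcongr
      linarith
    isOpen := hI
    pos := fun r hr => hr.1
    down := fun s hs t ht hts => Iset_down hs ht hts
    cont_p := continuous_extendConst hR (hsol.smooth_u.continuousOn.div_const _) hAu hBu
    cont_w := continuous_extendConst hR hsol.smooth_v.continuousOn.neg hA.neg hBv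
    out := fun r h0 hr => ⟨extendConst_of_notMem h0 hr, extendConst_of_notMem h0 hr⟩
    p_zero := extendConst_of_nonpos le_rfl
    p_pos := fun r hr => by
      rw [extendConst_of_mem hr]
      exact div_pos (hu r hr) h3p
    endpoint := fun ε hε => by
      obtain ⟨M, hM, hMb⟩ := extendConst_endpoint (A := 0) hR hBu (Metric.ball_mem_nhds ω hε)
      obtain ⟨N, hN, hNb⟩ := extendConst_endpoint (A := -A) hR hBv (Metric.ball_mem_nhds ω hε)
      exact ⟨max M N, by rcases max_choice M N with e | e <;> rw [e] <;> assumption,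
        fun r hr => ⟨hMb r ((le_max_left _ _).trans hr), hNb r ((le_max_right _ _).trans hr)⟩⟩
    deriv_p := fun r hr => ((hdu r hr).1.div_const _).congr_of_eventuallyEq (heq r hr _ _)
    deriv_p' := fun r hr => (hdu r hr).2.div_const _
    deriv_w := fun r hr => (hdv r hr).1.neg.congr_of_eventuallyEq (heq r hr _ _)
    deriv_w' := fun r hr => (hdv r hr).2.neg
    ode_p := fun r hr => by
      have h := hsol.ode_u r hr
      rw [extendConst_of_mem hr, extendConst_of_mem hr]
      have e : u r ^ 2 = 3 * (u r / √3) ^ 2 := by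
        rw [div_pow, h3]
        ring
      rw [hfun, e] at h
      have h' : deriv (deriv u) r / √3 + deriv u r / √3 / r =
          (deriv (deriv u) r + deriv u r / r) / √3 := by ring
      rw [h', eq_add_of_sub_eq h]
      ring
    ode_w := fun r hr => by
      have h := hsol.ode_v r hr
      rw [extendConst_of_mem hr, extendConst_of_mem hr]
      have e : u r ^ 2 = 3 * (u r / √3) ^ 2 := by
        rw [div_pow, h3]
        ring
      rw [gfun, e] at h
      have h' : -deriv (deriv v) r + -deriv v r / r =
          -(deriv (deriv v) r + deriv v r / r) := by ring
      rw [h', h]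
      ring
    w'_zero := by simpa using hsol.bc0_v.neg }

/-- **Monotonicity, supercritical case `b⁴ > 3a²c²`**: for any profile solution with `u > 0`
and `v < 0` on `(0,R)`, `u' > 0` and `v' < 0` on `(0,R)`. -/
theorem stmt2 (a2 b2 c2 : ℝ) (ha : 0 ≤ a2) (hb : 0 < b2) (hc : 0 < c2)
    (hsup : 3 * a2 * c2 < b2 ^ 2) (k : ℤ) (hk : k ≠ 0) (R : ℝ≥0∞) (hR : 0 < R)
    (u v : ℝ → ℝ) (hsol : ProfileSolution a2 b2 c2 k R u v)
    (hu : ∀ r ∈ Iset R, 0 < u r) (hv : ∀ r ∈ Iset R, v r < 0) :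
    ∀ r ∈ Iset R, 0 < deriv u r ∧ deriv v r < 0 := by
  intro r hr
  obtain ⟨p, w, h⟩ := hsol.exists_rescaledProfile ha hb hc hsup hk hR hu
  obtain ⟨h1, h2⟩ := h.deriv_pos hr
  exact ⟨(div_pos_iff_of_pos_right (by positivity)).1 h1, neg_pos.1 h2⟩

end
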